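/- Let R be a Dedekind domain, let N be a positive integer with (N : R) ≠ 0 in R, let P ∈ R, let 𝔞 = span{P, (N : R)}, and let 𝔟 be an ideal of R with 𝔞 · 𝔟 = span{(N : R)}. Then for every α ∈ R: (there exists c ∈ ℤ with gcd(c, N) = 1 and (α − c)·P ∈ span{(N : R)}) if and only if (there exists c ∈ ℤ with gcd(c, N) = 1 and α − c ∈ 𝔟). That is, α·P ≡ c·P (mod N) for some integer c coprime to N if and only if α ≡ c (mod 𝔟) for some integer c coprime to N. -/

import Mathlib

theorem mul_mem_span_singleton_iff_mem_of_span_pair_mul_eq {R : Type*} [CommRing R] [IsDomain R]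
    {n p : R} (hn : n ≠ 0) {𝔟 : Ideal R}
    (h : Ideal.span {p, n} * 𝔟 = Ideal.span {n}) (x : R) :
    x * p ∈ Ideal.span ({n} : Set R) ↔ x ∈ 𝔟 := by
  constructor
  · intro hx
    have hle : Ideal.span {x} * Ideal.span {p, n} ≤ Ideal.span {n} := by
      rw [Ideal.span_singleton_mul_le_iff]
      intro z hz
      obtain ⟨a, b, rfl⟩ := Ideal.mem_span_pair.mp hz
      have hab : x * (a * p + b * n) = a * (x * p) + x * b * n := by ring
      rw [hab]
      exact add_mem (Ideal.mul_mem_left _ _ hx)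
        (Ideal.mul_mem_left _ _ (Ideal.mem_span_singleton_self n))
    have hmul : Ideal.span {n} * Ideal.span {x} ≤ Ideal.span {n} * 𝔟 := by
      calc Ideal.span {n} * Ideal.span {x}
          = Ideal.span {x} * Ideal.span {p, n} * 𝔟 := by rw [mul_assoc, h, mul_comm]
        _ ≤ Ideal.span {n} * 𝔟 := Ideal.mul_mono_left hle
    rwa [Ideal.span_singleton_mul_right_mono hn, Ideal.span_singleton_le_iff_mem] at hmul
  · intro hx
    rw [mul_comm, ← h]
    exact Ideal.mul_mem_mul (Ideal.subset_span (Set.mem_insert p {n})) hx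

theorem stab_gamma0 {R : Type*} [CommRing R] [IsDomain R] [IsDedekindDomain R]
    (N : ℕ) (hNpos : 0 < N) (hN : (N : R) ≠ 0) (P : R) (𝔟 : Ideal R)
    (h : Ideal.span {P, (N : R)} * 𝔟 = Ideal.span {(N : R)}) (α : R) :
    (∃ c : ℤ, Int.gcd c N = 1 ∧ (α - (c : R)) * P ∈ Ideal.span ({(N : R)} : Set R)) ↔
      (∃ c : ℤ, Int.gcd c N = 1 ∧ α - (c : R) ∈ 𝔟) := by
  simp only [mul_mem_span_singleton_iff_mem_of_span_pair_mul_eq hN h]
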